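/- Let θ ∈ (−1,1), let φ_θ(x,y) = (1/(2π√(1−θ²))) exp(−(x² − 2θxy + y²)/(2(1−θ²))) be the standardized bivariate normal density with correlation θ, let f(z) = (1/√(2π)) e^{−z²/2} be the standard normal density, and let F_θ(a,b) = ∫_{−∞}^a ∫_{−∞}^b φ_θ(x,y) dy dx. Then ∫_{−∞}^{+∞} F_θ(z, −z) f(z) dz = 1/4 + (1/(2π)) arcsin((θ−1)/2). Consequently, the W-footrule coefficient of the Gaussian copula with parameter θ equals Φ_{C_θ} = 1/2 + (3/π) arcsin((θ−1)/2). -/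

import Mathlib

open MeasureTheory Real

/-- integrand after shifting -/
noncomputable def wfG (θ z u v : ℝ) : ℝ :=
  Real.exp (-((u + z) ^ 2 - 2 * θ * (u + z) * (v + -z) + (v + -z) ^ 2) / (2 * (1 - θ ^ 2))) *
    Real.exp (-z ^ 2 / 2)

lemma wf_quad (θ : ℝ) (h1 : -1 < θ) (h2 : θ < 1) (x y : ℝ) :
    -(x ^ 2 - 2 * θ * x * y + y ^ 2) / (2 * (1 - θ ^ 2)) ≤ -(x ^ 2 + y ^ 2) / 4 := by
  have hpos : 0 < 1 - θ ^ 2 := by nlinarith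
  rw [div_le_div_iff₀ (by positivity) (by norm_num)]
  have e1 : 0 ≤ (1 + θ) ^ 2 * (x - y) ^ 2 := by positivity
  have e2 : 0 ≤ (1 - θ) ^ 2 * (x + y) ^ 2 := by positivity
  nlinarith

lemma wfG_le (θ : ℝ) (h1 : -1 < θ) (h2 : θ < 1) (z u v : ℝ) :
    wfG θ z u v ≤ Real.exp (-(1 / 4) * z ^ 2) *
      (Real.exp (-(1 / 12) * u ^ 2) * Real.exp (-(1 / 12) * v ^ 2)) := by
  unfold wfG
  rw [← Real.exp_add, ← Real.exp_add, ← Real.exp_add]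
  apply Real.exp_le_exp.2
  have h := wf_quad θ h1 h2 (u + z) (v + -z)
  nlinarith [sq_nonneg (3 * z + (u - v)), sq_nonneg (u + v)]

lemma wfG_nonneg (θ z u v : ℝ) : 0 ≤ wfG θ z u v := by unfold wfG; positivity

lemma wf_slice (θ : ℝ) (h1 : -1 < θ) (h2 : θ < 1) (z : ℝ) (μ : Measure ℝ) [SFinite μ]
    (hμ : ∀ g : ℝ → ℝ, Integrable g → Integrable g μ) :
    Integrable (fun p : ℝ × ℝ => wfG θ z p.1 p.2) (μ.prod μ) := by
  have hb : Integrable (fun x : ℝ => Real.exp (-(1 / 12) * x ^ 2)) μ :=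
    hμ _ (integrable_exp_neg_mul_sq (by norm_num))
  refine ((hb.mul_prod hb).const_mul (Real.exp (-(1 / 4) * z ^ 2))).mono' ?_ ?_
  · apply Continuous.aestronglyMeasurable
    unfold wfG
    fun_prop
  · refine Filter.Eventually.of_forall fun p => ?_
    rw [Real.norm_of_nonneg (wfG_nonneg _ _ _ _)]
    exact wfG_le θ h1 h2 z p.1 p.2

lemma wf_triple (θ : ℝ) (h1 : -1 < θ) (h2 : θ < 1) (μ : Measure ℝ) [SFinite μ]
    (hμ : ∀ g : ℝ → ℝ, Integrable g → Integrable g μ) :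
    Integrable (fun q : ℝ × (ℝ × ℝ) => wfG θ q.1 q.2.1 q.2.2)
      ((volume : Measure ℝ).prod (μ.prod μ)) := by
  have hb : Integrable (fun x : ℝ => Real.exp (-(1 / 12) * x ^ 2)) μ :=
    hμ _ (integrable_exp_neg_mul_sq (by norm_num))
  have hz : Integrable (fun x : ℝ => Real.exp (-(1 / 4) * x ^ 2)) :=
    integrable_exp_neg_mul_sq (by norm_num)
  refine (hz.mul_prod (hb.mul_prod hb)).mono' ?_ ?_
  · apply Continuous.aestronglyMeasurable
    unfold wfG
    fun_prop
  · refine Filter.Eventually.of_forall fun p => ?_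
    rw [Real.norm_of_nonneg (wfG_nonneg _ _ _ _)]
    exact wfG_le θ h1 h2 p.1 p.2.1 p.2.2

lemma wf_intz (θ : ℝ) (h1 : -1 < θ) (h2 : θ < 1) (u v : ℝ) :
    ∫ z, wfG θ z u v = √(π / ((3 - θ) / (2 * (1 - θ)))) *
      Real.exp (-(u ^ 2 + 2 * ((1 - θ) / 2) * u * v + v ^ 2) / ((3 - θ) * (1 + θ))) := by
  have a1 : 1 - θ ≠ 0 := by linarith
  have a2 : 1 + θ ≠ 0 := by linarith
  have a3 : 3 - θ ≠ 0 := by linarith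
  have a4 : 1 - θ ^ 2 ≠ 0 := by nlinarith
  have e : ∀ z, wfG θ z u v =
      Real.exp (-((3 - θ) / (2 * (1 - θ))) * (z + (u - v) / (3 - θ)) ^ 2) *
      Real.exp (-(u ^ 2 + 2 * ((1 - θ) / 2) * u * v + v ^ 2) / ((3 - θ) * (1 + θ))) := by
    intro z
    unfold wfG
    rw [← Real.exp_add, ← Real.exp_add]
    congr 1
    rw [show 1 - θ ^ 2 = (1 - θ) * (1 + θ) by ring]
    field_simp
    ring
  simp_rw [e]
  rw [integral_mul_const,
    integral_add_right_eq_self (fun z => Real.exp (-((3 - θ) / (2 * (1 - θ))) * z ^ 2)),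
    integral_gaussian]

lemma wf_shift (g : ℝ → ℝ) (a : ℝ) : ∫ x in Set.Iic a, g x = ∫ x in Set.Iic 0, g (x + a) := by
  rw [← integral_indicator measurableSet_Iic, ← integral_indicator measurableSet_Iic,
    ← integral_add_right_eq_self _ a]
  congr 1
  ext x
  simp [Set.indicator]

lemma wf_radial (a : ℝ) (ha : 0 < a) :
    ∫ u in Set.Ioi (0 : ℝ), u * Real.exp (-a * u ^ 2) = (2 * a)⁻¹ := by
  have h := integral_mul_cexp_neg_mul_sq (b := (a : ℂ)) (by simpa using ha)
  have h' : ((∫ u in Set.Ioi (0 : ℝ), u * Real.exp (-a * u ^ 2) : ℝ) : ℂ) = ((2 * a)⁻¹ : ℝ) := by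
    rw [← integral_complex_ofReal]
    push_cast
    exact h
  exact_mod_cast h'

lemma wf_arctan (c : ℝ) (h0 : 0 < c) (h1 : c < 1) :
    IntegrableOn (fun t : ℝ => (1 + 2 * c * t + t ^ 2)⁻¹) (Set.Ioi 0) ∧
    ∫ t in Set.Ioi (0 : ℝ), (1 + 2 * c * t + t ^ 2)⁻¹ =
      (π / 2 - arcsin c) / √(1 - c ^ 2) := by
  have hp : 0 < 1 - c ^ 2 := by nlinarith
  set s := √(1 - c ^ 2) with hs
  have hs0 : 0 < s := Real.sqrt_pos.2 hp
  have hs2 : s ^ 2 = 1 - c ^ 2 := Real.sq_sqrt hp.le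
  have hd : ∀ t ∈ Set.Ici (0 : ℝ), HasDerivAt (fun t => arctan ((t + c) / s) / s)
      ((1 + 2 * c * t + t ^ 2)⁻¹) t := by
    intro t ht
    have ht : 0 ≤ t := ht
    have := ((((hasDerivAt_id t).add_const c).div_const s).arctan).div_const s
    refine this.congr_deriv ?_
    have q : 0 < 1 + 2 * c * t + t ^ 2 := by positivity
    have : 1 + ((id t + c) / s) ^ 2 = (1 + 2 * c * t + t ^ 2) / s ^ 2 := by
      field_simp
      rw [hs2]; simp only [id]; ring
    simp only [id] at this ⊢
    rw [this]
    field_simp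
  have hn : ∀ t ∈ Set.Ioi (0 : ℝ), 0 ≤ (1 + 2 * c * t + t ^ 2)⁻¹ := by
    intro t ht
    have ht : 0 < t := ht
    positivity
  have hl : Filter.Tendsto (fun t => arctan ((t + c) / s) / s) Filter.atTop
      (nhds ((π / 2) / s)) := by
    refine Filter.Tendsto.div_const ?_ s
    refine (tendsto_nhds_of_tendsto_nhdsWithin tendsto_arctan_atTop).comp ?_
    exact (Filter.tendsto_atTop_add_const_right _ c Filter.tendsto_id).atTop_div_const hs0
  refine ⟨integrableOn_Ioi_deriv_of_nonneg' hd hn hl, ?_⟩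
  rw [integral_Ioi_of_hasDerivAt_of_nonneg' hd hn hl, arcsin_eq_arctan ⟨by linarith, h1⟩, ← hs]
  simp only [zero_add]
  ring

lemma wf_orthant (c D : ℝ) (h0 : 0 < c) (h1 : c < 1) (hD : 0 < D) :
    ∫ u in Set.Iic (0 : ℝ), ∫ v in Set.Iic (0 : ℝ),
      Real.exp (-(u ^ 2 + 2 * c * u * v + v ^ 2) / D) =
    D / 2 * ((π / 2 - arcsin c) / √(1 - c ^ 2)) := by
  have s1 : ∫ u in Set.Iic (0 : ℝ), ∫ v in Set.Iic (0 : ℝ),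
      Real.exp (-(u ^ 2 + 2 * c * u * v + v ^ 2) / D) =
      ∫ u in Set.Ioi (0 : ℝ), ∫ v in Set.Ioi (0 : ℝ),
      Real.exp (-(u ^ 2 + 2 * c * u * v + v ^ 2) / D) := by
    have := integral_comp_neg_Iic 0 (fun u => ∫ v in Set.Ioi (0 : ℝ),
      Real.exp (-(u ^ 2 + 2 * c * u * v + v ^ 2) / D))
    rw [neg_zero] at this
    rw [← this]
    congr 1
    ext u
    have := integral_comp_neg_Iic 0 (fun v =>
      Real.exp (-((-u) ^ 2 + 2 * c * (-u) * v + v ^ 2) / D))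
    rw [neg_zero] at this
    rw [← this]
    congr 1
    ext v
    congr 1
    ring
  have s2 : ∫ u in Set.Ioi (0 : ℝ), ∫ v in Set.Ioi (0 : ℝ),
      Real.exp (-(u ^ 2 + 2 * c * u * v + v ^ 2) / D) =
      ∫ u in Set.Ioi (0 : ℝ), ∫ t in Set.Ioi (0 : ℝ),
        u * Real.exp (-((1 + 2 * c * t + t ^ 2) / D) * u ^ 2) := by
    refine setIntegral_congr_fun measurableSet_Ioi fun u hu => ?_
    have := integral_comp_mul_left_Ioi' (fun v =>
      Real.exp (-(u ^ 2 + 2 * c * u * v + v ^ 2) / D)) 0 hu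
    rw [mul_zero] at this
    rw [← this, integral_const_mul, smul_eq_mul]
    congr 2
    ext t
    congr 1
    ring
  obtain ⟨hi, hv⟩ := wf_arctan c h0 h1
  have inner : ∀ t ∈ Set.Ioi (0 : ℝ), ∫ u in Set.Ioi (0 : ℝ),
      u * Real.exp (-((1 + 2 * c * t + t ^ 2) / D) * u ^ 2) =
      D / 2 * (1 + 2 * c * t + t ^ 2)⁻¹ := by
    intro t ht
    have ht : 0 < t := ht
    rw [wf_radial _ (by positivity)]
    field_simp
  have hint : Integrable (Function.uncurry fun u t : ℝ =>
      u * Real.exp (-((1 + 2 * c * t + t ^ 2) / D) * u ^ 2))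
      ((volume.restrict (Set.Ioi (0 : ℝ))).prod (volume.restrict (Set.Ioi (0 : ℝ)))) := by
    rw [integrable_prod_iff']
    · constructor
      · filter_upwards [ae_restrict_mem measurableSet_Ioi] with t ht
        have ht : 0 < t := ht
        have hb : 0 < (1 + 2 * c * t + t ^ 2) / D := by positivity
        exact (integrable_mul_exp_neg_mul_sq hb).integrableOn
      · refine (hi.const_mul (D / 2)).congr ?_
        filter_upwards [ae_restrict_mem measurableSet_Ioi] with t ht
        rw [← inner t ht]
        refine setIntegral_congr_fun measurableSet_Ioi fun u hu => ?_
        have hu : 0 < u := hu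
        simp only [Function.uncurry]
        rw [Real.norm_of_nonneg (by positivity)]
    · apply Continuous.aestronglyMeasurable
      unfold Function.uncurry
      fun_prop
  rw [s1, s2, integral_integral_swap hint, setIntegral_congr_fun measurableSet_Ioi inner,
    integral_const_mul, hv]

lemma wf_main (θ : ℝ) (h1 : -1 < θ) (h2 : θ < 1) :
    ∫ z, (∫ u in Set.Iic (0 : ℝ), ∫ v in Set.Iic (0 : ℝ), wfG θ z u v) =
      √(π / ((3 - θ) / (2 * (1 - θ)))) * (((3 - θ) * (1 + θ)) / 2 *
        ((π / 2 - arcsin ((1 - θ) / 2)) / √(1 - ((1 - θ) / 2) ^ 2))) := by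
  have hμ : ∀ g : ℝ → ℝ, Integrable g → Integrable g (volume.restrict (Set.Iic (0 : ℝ))) :=
    fun g hg => hg.integrableOn
  have ht := wf_triple θ h1 h2 _ hμ
  have e1 : ∀ z, (∫ u in Set.Iic (0 : ℝ), ∫ v in Set.Iic (0 : ℝ), wfG θ z u v) =
      ∫ p, wfG θ z p.1 p.2 ∂((volume.restrict (Set.Iic (0 : ℝ))).prod
        (volume.restrict (Set.Iic (0 : ℝ)))) := fun z =>
    (integral_prod _ (wf_slice θ h1 h2 z _ hμ)).symm
  simp_rw [e1]
  rw [integral_integral_swap (f := fun z (p : ℝ × ℝ) => wfG θ z p.1 p.2) ht,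
    integral_prod _ ht.integral_prod_right]
  simp_rw [wf_intz θ h1 h2, integral_const_mul]
  rw [wf_orthant _ _ (by linarith) (by linarith) (by nlinarith)]

/-- for the standardized bivariate normal distribution function `F_θ`
with correlation `θ ∈ (−1,1)` and the standard normal density `f`,
`∫_ℝ F_θ(z, −z) f(z) dz = 1/4 + arcsin((θ−1)/2)/(2π)`; consequently the W-footrule
coefficient of the Gaussian copula with parameter `θ`, which equals
`6 ∫_ℝ F_θ(z,−z) f(z) dz − 1`, is `1/2 + (3/π) arcsin((θ−1)/2)`. -/
theorem gaussian_copula_WFootrule (θ : ℝ) (hθ : θ ∈ Set.Ioo (-1 : ℝ) 1)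
    (φ : ℝ → ℝ → ℝ)
    (hφ : ∀ x y : ℝ, φ x y =
      (1 / (2 * π * Real.sqrt (1 - θ ^ 2))) *
        Real.exp (-(x ^ 2 - 2 * θ * x * y + y ^ 2) / (2 * (1 - θ ^ 2))))
    (f : ℝ → ℝ) (hf : ∀ z : ℝ, f z = (1 / Real.sqrt (2 * π)) * Real.exp (-z ^ 2 / 2))
    (F : ℝ → ℝ → ℝ)
    (hF : ∀ a b : ℝ, F a b = ∫ x in Set.Iic a, ∫ y in Set.Iic b, φ x y) :
    (∫ z : ℝ, F z (-z) * f z) = 1 / 4 + arcsin ((θ - 1) / 2) / (2 * π) ∧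
    6 * (∫ z : ℝ, F z (-z) * f z) - 1 = 1 / 2 + (3 / π) * arcsin ((θ - 1) / 2) := by
  obtain ⟨h1, h2⟩ := hθ
  have a1 : 0 < 1 - θ := by linarith
  have a2 : 0 < 1 + θ := by linarith
  have a3 : 0 < 3 - θ := by linarith
  have key : (∫ z : ℝ, F z (-z) * f z) = 1 / 4 + arcsin ((θ - 1) / 2) / (2 * π) := by
    have e : ∀ z, F z (-z) * f z = (1 / (2 * π * √(1 - θ ^ 2)) * (1 / √(2 * π))) *
        ∫ u in Set.Iic (0 : ℝ), ∫ v in Set.Iic (0 : ℝ), wfG θ z u v := by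
      intro z
      rw [hF, hf, wf_shift]
      simp_rw [wf_shift _ (-z), hφ, wfG, integral_const_mul, integral_mul_const]
      ring
    simp_rw [e]
    rw [integral_const_mul, wf_main θ h1 h2,
      show (θ - 1) / 2 = -((1 - θ) / 2) by ring, arcsin_neg]
    have hc : 1 / (2 * π * √(1 - θ ^ 2)) * (1 / √(2 * π)) * √(π / ((3 - θ) / (2 * (1 - θ)))) *
        ((3 - θ) * (1 + θ) / 2) / √(1 - ((1 - θ) / 2) ^ 2) = 1 / (2 * π) := by
      have k1 : √(1 - ((1 - θ) / 2) ^ 2) = √(3 - θ) * √(1 + θ) / 2 := by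
        rw [show 1 - ((1 - θ) / 2) ^ 2 = (3 - θ) * (1 + θ) / 2 ^ 2 by ring,
          Real.sqrt_div (by positivity), Real.sqrt_mul a3.le, Real.sqrt_sq (by norm_num)]
      have k2 : √(1 - θ ^ 2) = √(1 - θ) * √(1 + θ) := by
        rw [← Real.sqrt_mul a1.le]; congr 1; ring
      have k3 : √(π / ((3 - θ) / (2 * (1 - θ)))) = √(2 * π) * √(1 - θ) / √(3 - θ) := by
        rw [← Real.sqrt_mul (by positivity), ← Real.sqrt_div (by positivity)]
        congr 1; field_simp
      have m1 : 0 < √(1 - θ) := Real.sqrt_pos.2 a1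
      have m2 : 0 < √(1 + θ) := Real.sqrt_pos.2 a2
      have m3 : 0 < √(3 - θ) := Real.sqrt_pos.2 a3
      have m4 : 0 < √(2 * π) := Real.sqrt_pos.2 (by positivity)
      have q2 : √(1 + θ) ^ 2 = 1 + θ := Real.sq_sqrt a2.le
      have q3 : √(3 - θ) ^ 2 = 3 - θ := Real.sq_sqrt a3.le
      rw [k1, k2, k3]
      generalize √(2 * π) = w at *
      generalize √(1 - θ) = p at *
      generalize √(1 + θ) = q at *
      generalize √(3 - θ) = r at *
      rw [← q2, ← q3]
      field_simp
    calc _ = (1 / (2 * π * √(1 - θ ^ 2)) * (1 / √(2 * π)) * √(π / ((3 - θ) / (2 * (1 - θ)))) *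
        ((3 - θ) * (1 + θ) / 2) / √(1 - ((1 - θ) / 2) ^ 2)) *
          (π / 2 - arcsin ((1 - θ) / 2)) := by ring
      _ = _ := by
        rw [hc]
        field_simp
        ring
  refine ⟨key, ?_⟩
  rw [key]
  field_simp
  ring
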